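/- Let N and M be positive integers and let Σ₁, …, Σ_M ∈ ℂ^{N×N} be Hermitian positive definite matrices. Then for every index n with 1 ≤ n ≤ M, the cross-entropy-type integral of the density p_{Σ_n} against the uniform Gaussian mixture satisfies the Jensen bound ∫_{ℂ^N} p_{Σ_n}(y) · log₂( (1/M) Σ_{t=1}^M p_{Σ_t}(y) ) dy ≤ -N · log₂ π + log₂( (1/M) Σ_{t=1}^M (det(Σ_n + Σ_t))^{-1} ). -/

import Mathlib

open MeasureTheory Matrix Real Filter
open scoped ComplexOrder

/-- The circularly symmetric complex Gaussian density
`p_Σ(y) = π^{-N} (det Σ)^{-1} exp(-y^* Σ^{-1} y)`. -/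
noncomputable def gaussDensity {N : ℕ} (S : Matrix (Fin N) (Fin N) ℂ)
    (y : Fin N → ℂ) : ℝ :=
  (Real.pi ^ N)⁻¹ * (S.det.re)⁻¹ * Real.exp (-(star y ⬝ᵥ S⁻¹.mulVec y).re)


lemma aux_std (N : ℕ) : ∫ y : Fin N → ℂ, Real.exp (-(star y ⬝ᵥ y).re) = π ^ N := by
  have h : ∀ y : Fin N → ℂ, Real.exp (-(star y ⬝ᵥ y).re) = ∏ i, Real.exp (-1 * ‖y i‖ ^ 2) := by
    intro y
    rw [← Real.exp_sum]
    congr 1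
    simp [dotProduct, ← Complex.normSq_eq_norm_sq, Complex.normSq_apply, Complex.mul_re]
    rw [← Finset.sum_neg_distrib]
    exact Finset.sum_congr rfl fun i _ => by ring
  simp_rw [h]
  rw [integral_fintype_prod_volume_eq_pow (fun z : ℂ => Real.exp (-1 * ‖z‖ ^ 2)),
    GaussianFourier.integral_rexp_neg_mul_sq_norm one_pos]
  simp

open scoped MatrixOrder in
lemma aux_sqrt {N : ℕ} {A : Matrix (Fin N) (Fin N) ℂ} (hA : A.PosDef) :
    ∃ B : Matrix (Fin N) (Fin N) ℂ, A = Bᴴ * B := by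
  have := hA.posSemidef.nonneg
  obtain ⟨B, hB⟩ := CStarAlgebra.nonneg_iff_eq_star_mul_self.mp this
  exact ⟨B, hB⟩

lemma detre_pos {N : ℕ} {A : Matrix (Fin N) (Fin N) ℂ} (hA : A.PosDef) : 0 < A.det.re := 
  (Complex.pos_iff.mp hA.det_pos).1

lemma aux_int {N : ℕ} {A : Matrix (Fin N) (Fin N) ℂ} (hA : A.PosDef) :
    ∫ y : Fin N → ℂ, Real.exp (-(star y ⬝ᵥ A *ᵥ y).re) = π ^ N * (A.det.re)⁻¹ := by
  obtain ⟨B, rfl⟩ := aux_sqrt hA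
  have hd : (Bᴴ * B).det.re = Complex.normSq B.det := by
    rw [det_mul, det_conjTranspose]
    simp [Complex.normSq_apply]
  have hpos := detre_pos hA
  rw [hd] at hpos ⊢
  let f : (Fin N → ℂ) →ₗ[ℝ] (Fin N → ℂ) := (Matrix.toLin' B).restrictScalars ℝ
  have hf : LinearMap.det f = Complex.normSq B.det := by
    simp [f, LinearMap.det_restrictScalars, Algebra.norm_complex_apply]
  have hf0 : LinearMap.det f ≠ 0 := by rw [hf]; exact hpos.ne'
  have hm := Measure.map_linearMap_addHaar_eq_smul_addHaar (volume : Measure (Fin N → ℂ)) hf0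
  have hfe : MeasurableEmbedding f := by
    have : Continuous f := f.continuous_of_finiteDimensional
    refine this.measurableEmbedding ?_
    have := (LinearMap.equivOfDetNeZero f hf0).injective
    exact this
  have key := hfe.integral_map (μ := volume) (fun y : Fin N → ℂ => Real.exp (-(star y ⬝ᵥ y).re))
  rw [hm, integral_smul_measure, aux_std] at key
  have e : ∀ y : Fin N → ℂ, (star y ⬝ᵥ (Bᴴ * B) *ᵥ y) = star (f y) ⬝ᵥ f y := by
    intro y
    simp only [f, LinearMap.coe_restrictScalars, toLin'_apply, star_mulVec, ← mulVec_mulVec,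
      ← dotProduct_mulVec]
  simp_rw [e]
  rw [← key, hf, ENNReal.toReal_ofReal (abs_nonneg _), abs_of_pos (inv_pos.2 hpos), smul_eq_mul, mul_comm]

lemma aux_integrable {N : ℕ} {A : Matrix (Fin N) (Fin N) ℂ} (hA : A.PosDef) :
    Integrable fun y : Fin N → ℂ => Real.exp (-(star y ⬝ᵥ A *ᵥ y).re) := by
  apply Integrable.of_integral_ne_zero
  rw [aux_int hA]
  have := detre_pos hA
  positivity

lemma aux_prod {N : ℕ} {S T : Matrix (Fin N) (Fin N) ℂ} (hS : S.PosDef) (hT : T.PosDef) :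
    Integrable (fun y => gaussDensity S y * gaussDensity T y) ∧
    ∫ y, gaussDensity S y * gaussDensity T y = (π ^ N)⁻¹ * ((S + T).det.re)⁻¹ := by
  have e : ∀ y : Fin N → ℂ, gaussDensity S y * gaussDensity T y =
      ((π ^ N)⁻¹ * (S.det.re)⁻¹ * ((π ^ N)⁻¹ * (T.det.re)⁻¹)) *
        Real.exp (-(star y ⬝ᵥ (S⁻¹ + T⁻¹) *ᵥ y).re) := by
    intro y
    rw [add_mulVec, dotProduct_add, Complex.add_re, neg_add, Real.exp_add]
    unfold gaussDensity
    ring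
  have hp := hS.inv.add hT.inv
  simp_rw [e]
  refine ⟨(aux_integrable hp).const_mul _, ?_⟩
  rw [integral_const_mul, aux_int hp]
  have hSu : IsUnit S.det := (isUnit_iff_isUnit_det _).1 hS.isUnit
  have hTu : IsUnit T.det := (isUnit_iff_isUnit_det _).1 hT.isUnit
  have h1 : S * (S⁻¹ + T⁻¹) * T = S + T := by
    rw [mul_add, mul_nonsing_inv _ hSu, add_mul, one_mul, mul_assoc, nonsing_inv_mul _ hTu, mul_one, add_comm]
  have h2 : (S + T).det.re = S.det.re * (S⁻¹ + T⁻¹).det.re * T.det.re := by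
    rw [← h1, det_mul, det_mul]
    have a := (Complex.pos_iff.mp hS.det_pos).2
    have b := (Complex.pos_iff.mp hT.det_pos).2
    have c := (Complex.pos_iff.mp hp.det_pos).2
    simp [Complex.mul_re, ← a, ← b, ← c]
  rw [h2]
  have a := detre_pos hS
  have b := detre_pos hT
  have c := detre_pos hp
  have := pi_pos
  field_simp

lemma gd_pos {N : ℕ} {S : Matrix (Fin N) (Fin N) ℂ} (hS : S.PosDef) (y) : 0 < gaussDensity S y := by
  have := detre_pos hS
  unfold gaussDensity
  positivity

lemma q_nonneg {N : ℕ} {S : Matrix (Fin N) (Fin N) ℂ} (hS : S.PosDef) (y : Fin N → ℂ) :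
    0 ≤ (star y ⬝ᵥ S⁻¹ *ᵥ y).re :=
  (Complex.nonneg_iff.mp (hS.inv.posSemidef.dotProduct_mulVec_nonneg y)).1

lemma gd_le {N : ℕ} {S : Matrix (Fin N) (Fin N) ℂ} (hS : S.PosDef) (y) :
    gaussDensity S y ≤ (π ^ N)⁻¹ * (S.det.re)⁻¹ := by
  have := detre_pos hS
  unfold gaussDensity
  apply mul_le_of_le_one_right (by positivity)
  simpa using q_nonneg hS y

lemma gd_int {N : ℕ} {S : Matrix (Fin N) (Fin N) ℂ} (hS : S.PosDef) :
    Integrable (gaussDensity S) ∧ ∫ y, gaussDensity S y = 1 := by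
  refine ⟨(aux_integrable hS.inv).const_mul _, ?_⟩
  unfold gaussDensity
  rw [integral_const_mul, aux_int hS.inv, det_nonsing_inv, Ring.inverse_eq_inv']
  have a := (Complex.pos_iff.mp hS.det_pos).2
  have b := detre_pos hS
  have : (S.det)⁻¹.re = (S.det.re)⁻¹ := by
    have : S.det = (S.det.re : ℂ) := Complex.ext rfl (by simp [← a])
    rw [this, ← Complex.ofReal_inv, Complex.ofReal_re, Complex.ofReal_re]
  rw [this]
  field_simp

lemma gd_cont {N : ℕ} (S : Matrix (Fin N) (Fin N) ℂ) : Continuous (gaussDensity S) := by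
  unfold gaussDensity
  fun_prop

/-- p_S * q_S is integrable -/
lemma gd_q_int {N : ℕ} {S : Matrix (Fin N) (Fin N) ℂ} (hS : S.PosDef) :
    Integrable fun y => gaussDensity S y * (star y ⬝ᵥ S⁻¹ *ᵥ y).re := by
  have hp : ((1/2 : ℝ) • S⁻¹).PosDef := hS.inv.smul (by norm_num)
  have hd := detre_pos hS
  refine ((aux_integrable hp).const_mul ((π ^ N)⁻¹ * (S.det.re)⁻¹ * 2)).mono'
    (by have := gd_cont S; fun_prop) (ae_of_all _ fun y => ?_)
  have hq := q_nonneg hS y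
  rw [Real.norm_of_nonneg (mul_nonneg (gd_pos hS y).le hq)]
  have e : (star y ⬝ᵥ ((1/2 : ℝ) • S⁻¹) *ᵥ y).re = (star y ⬝ᵥ S⁻¹ *ᵥ y).re / 2 := by
    rw [smul_mulVec, dotProduct_smul, Complex.smul_re, smul_eq_mul]; ring
  rw [e]
  unfold gaussDensity
  generalize (star y ⬝ᵥ S⁻¹ *ᵥ y).re = q at *
  rw [mul_assoc, mul_assoc _ 2]
  refine mul_le_mul_of_nonneg_left ?_ (by positivity)
  have h1 : Real.exp (-q) = Real.exp (-(q/2)) * Real.exp (-(q/2)) := by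
    rw [← Real.exp_add]; ring_nf
  have h2 : q / 2 * Real.exp (-(q/2)) ≤ 1 := by
    have := Real.add_one_le_exp (q/2)
    rw [Real.exp_neg, ← div_eq_mul_inv, div_le_one (Real.exp_pos _)]; linarith
  rw [h1]
  nlinarith [Real.exp_pos (-(q/2))]

lemma main_log (N M : ℕ) (hM : 0 < M)
    (S : Fin M → Matrix (Fin N) (Fin N) ℂ) (hS : ∀ t, (S t).PosDef) (n : Fin M) :
    (∫ y : Fin N → ℂ,
        gaussDensity (S n) y * Real.log ((1 / (M : ℝ)) * ∑ t, gaussDensity (S t) y))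
      ≤ Real.log ((π ^ N)⁻¹ * ((1 / (M : ℝ)) * ∑ t, (((S n) + (S t)).det.re)⁻¹)) := by
  have hM' : (0 : ℝ) < M := by exact_mod_cast hM
  set f : (Fin N → ℂ) → ℝ := fun y => (1 / (M : ℝ)) * ∑ t, gaussDensity (S t) y with hf
  set c := (π ^ N)⁻¹ * ((1 / (M : ℝ)) * ∑ t, (((S n) + (S t)).det.re)⁻¹) with hc
  have hne : (Finset.univ : Finset (Fin M)).Nonempty := ⟨n, Finset.mem_univ _⟩
  have hfpos : ∀ y, 0 < f y := fun y =>
    mul_pos (by positivity) (Finset.sum_pos (fun t _ => gd_pos (hS t) y) hne)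
  have hcpos : 0 < c := by
    have := Finset.sum_pos (fun t _ => inv_pos.2 (detre_pos ((hS n).add (hS t)))) hne
    positivity
  have e : ∀ y, gaussDensity (S n) y * f y =
      (1 / (M : ℝ)) * ∑ t, gaussDensity (S n) y * gaussDensity (S t) y := by
    intro y
    simp only [hf]
    rw [← Finset.mul_sum]; ring
  have hpf : Integrable fun y => gaussDensity (S n) y * f y := by
    simp_rw [e]
    exact (integrable_finsetSum _ fun t _ => (aux_prod (hS n) (hS t)).1).const_mul _
  have hpfi : ∫ y, gaussDensity (S n) y * f y = c := by
    simp_rw [e]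
    rw [integral_const_mul, integral_finsetSum _ fun t _ => (aux_prod (hS n) (hS t)).1]
    simp_rw [(aux_prod (hS n) (hS _)).2]
    rw [← Finset.mul_sum, hc]; ring
  have hfc : Continuous f := by
    have := fun t => gd_cont (S t)
    simp only [hf]; fun_prop
  obtain ⟨hp, hp1⟩ := gd_int (hS n)
  -- bounds
  have hup : ∀ y, Real.log (f y) ≤ Real.log c + (f y / c - 1) := by
    intro y
    have := Real.log_le_sub_one_of_pos (div_pos (hfpos y) hcpos)
    rw [Real.log_div (hfpos y).ne' hcpos.ne'] at this
    linarith
  set k := (1 / (M : ℝ)) * ((π ^ N)⁻¹ * ((S n).det.re)⁻¹) with hk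
  have hkpos : 0 < k := by have := detre_pos (hS n); positivity
  have hlo : ∀ y, Real.log k - (star y ⬝ᵥ (S n)⁻¹ *ᵥ y).re ≤ Real.log (f y) := by
    intro y
    have h1 : k * Real.exp (-(star y ⬝ᵥ (S n)⁻¹ *ᵥ y).re) ≤ f y := by
      rw [hk, mul_assoc]
      refine mul_le_mul_of_nonneg_left ?_ (by positivity)
      exact Finset.single_le_sum (f := fun t => gaussDensity (S t) y)
        (fun t _ => (gd_pos (hS t) y).le) (Finset.mem_univ n)
    have h2 := Real.log_le_log (mul_pos hkpos (Real.exp_pos _)) h1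
    rw [Real.log_mul hkpos.ne' (Real.exp_pos _).ne', Real.log_exp] at h2
    linarith
  have hU : Integrable fun y => gaussDensity (S n) y * (Real.log c + (f y / c - 1)) := by
    have := (hp.const_mul (Real.log c - 1)).add (hpf.const_mul c⁻¹)
    refine this.congr (ae_of_all _ fun y => ?_)
    simp only [Pi.add_apply]
    ring
  have hL : Integrable fun y => gaussDensity (S n) y *
      (Real.log k - (star y ⬝ᵥ (S n)⁻¹ *ᵥ y).re) := by
    refine ((hp.const_mul (Real.log k)).sub (gd_q_int (hS n))).congr (ae_of_all _ fun y => ?_)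
    simp only [Pi.sub_apply]
    ring
  have hI : Integrable fun y => gaussDensity (S n) y * Real.log (f y) := by
    refine integrable_of_le_of_le ?_ (ae_of_all _ fun y => ?_) (ae_of_all _ fun y => ?_) hL hU
    · have h3 : Continuous fun y => Real.log (f y) := hfc.log fun y => (hfpos y).ne'
      exact ((gd_cont (S n)).mul h3).aestronglyMeasurable
    · exact mul_le_mul_of_nonneg_left (hlo y) (gd_pos (hS n) y).le
    · exact mul_le_mul_of_nonneg_left (hup y) (gd_pos (hS n) y).le
  calc _ ≤ ∫ y, gaussDensity (S n) y * (Real.log c + (f y / c - 1)) :=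
        integral_mono hI hU fun y => mul_le_mul_of_nonneg_left (hup y) (gd_pos (hS n) y).le
    _ = ∫ y, ((Real.log c - 1) * gaussDensity (S n) y + c⁻¹ * (gaussDensity (S n) y * f y)) := by
        congr 1; ext y; ring
    _ = Real.log c := by
        rw [integral_add (hp.const_mul _) (hpf.const_mul _), integral_const_mul,
          integral_const_mul, hp1, hpfi, inv_mul_cancel₀ hcpos.ne']
        ring

/-- Jensen bound on the cross-entropy-type integral of a Gaussian
density against a uniform Gaussian mixture:
`∫ p_{Σ_n}(y) · log₂((1/M)·Σ_t p_{Σ_t}(y)) dy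
   ≤ -N·log₂ π + log₂((1/M)·Σ_t (det(Σ_n+Σ_t))^{-1})`. -/
theorem gaussian_mixture_jensen_bound (N M : ℕ) (hN : 0 < N) (hM : 0 < M)
    (S : Fin M → Matrix (Fin N) (Fin N) ℂ) (hS : ∀ t, (S t).PosDef) (n : Fin M) :
    (∫ y : Fin N → ℂ,
        gaussDensity (S n) y * Real.logb 2 ((1 / (M : ℝ)) * ∑ t, gaussDensity (S t) y))
      ≤ -(N : ℝ) * Real.logb 2 Real.pi
          + Real.logb 2 ((1 / (M : ℝ)) * ∑ t, (((S n) + (S t)).det.re)⁻¹) := by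
  have h := main_log N M hM S hS n
  have hM' : (0 : ℝ) < M := by exact_mod_cast hM
  have hs : 0 < (1 / (M : ℝ)) * ∑ t, (((S n) + (S t)).det.re)⁻¹ :=
    mul_pos (by positivity) (Finset.sum_pos
      (fun t _ => inv_pos.2 (detre_pos ((hS n).add (hS t)))) ⟨n, Finset.mem_univ _⟩)
  rw [Real.log_mul (by positivity) hs.ne', Real.log_inv, Real.log_pow] at h
  unfold Real.logb
  simp_rw [← mul_div_assoc]
  rw [integral_div, ← add_div]
  have h2 : 0 < Real.log 2 := Real.log_pos one_lt_two
  gcongr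
  linarith
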